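/- arXiv:2401.04509 — 9 statements merged into one kernel-verified Lean document; each statement's English description precedes it below -/
import Mathlib

section
/- Let T be a string of length n ≥ 3. Then the number of nodes of the linear-size suffix trie of T, i.e. the cardinality of the (disjoint) union RightM(T) ∪ QuasiRightM(T), is at most 3n − 3; equivalently, |RightM(T)| + |QuasiRightM(T)| ≤ 3n − 3. -/
def Substr {α : Type*} (T w : List α) : Prop := ∃ x z : List α, T = x ++ w ++ z

def RightM {α : Type*} (T : List α) : Set (List α) :=
  {w | Substr T w ∧ ((∃ a b : α, a ≠ b ∧ Substr T (w ++ [a]) ∧ Substr T (w ++ [b])) ∨ w <:+ T)}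

def QuasiRightM {α : Type*} (T : List α) : Set (List α) :=
  {w | ∃ (c : α) (u : List α), w = c :: u ∧ u ∈ RightM T ∧ Substr T (c :: u) ∧ (c :: u) ∉ RightM T}

theorem substr_iff_isInfix {α : Type*} {T w : List α} : Substr T w ↔ w <:+: T :=
  ⟨fun ⟨x, z, h⟩ => ⟨x, z, h.symm⟩, fun ⟨x, z, h⟩ => ⟨x, z, h.symm⟩⟩

theorem finite_setOf_isInfix {α : Type*} (T : List α) : {w | w <:+: T}.Finite := by
  classical
  refine T.sublists.toFinset.finite_toSet.subset fun w hw => ?_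
  simpa using List.IsInfix.sublist hw

theorem rightM_finite {α : Type*} (T : List α) : (RightM T).Finite :=
  (finite_setOf_isInfix T).subset fun _ hw => substr_iff_isInfix.1 hw.1

theorem mem_rightM_of_isSuffix {α : Type*} {T w : List α} (h : w <:+ T) : w ∈ RightM T :=
  ⟨substr_iff_isInfix.2 h.isInfix, Or.inr h⟩

theorem mem_rightM_of_isSuffix_of_mem {α : Type*} {T v w : List α} (hv : v <:+ w)
    (hw : w ∈ RightM T) : v ∈ RightM T := by
  obtain ⟨hs, ⟨a, b, hab, ha, hb⟩ | hw⟩ := hw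
  · have extend (c : α) (hc : Substr T (w ++ [c])) : Substr T (v ++ [c]) := by
      rw [substr_iff_isInfix] at hc ⊢
      obtain ⟨x, rfl⟩ := hv
      exact List.IsInfix.trans ⟨x, [], by simp⟩ hc
    exact ⟨substr_iff_isInfix.2 (hv.isInfix.trans (substr_iff_isInfix.1 hs)),
      Or.inl ⟨a, b, hab, extend a ha, extend b hb⟩⟩
  · exact mem_rightM_of_isSuffix (hv.trans hw)

/-- A right-maximal string that appears when `c` is prepended to `T`, other than `c :: T`, is the
longest prefix of `c :: T` that occurs in `T`. -/
theorem exists_prefix_of_mem_rightM_cons {α : Type*} {c : α} {T w : List α}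
    (hw : w ∈ RightM (c :: T)) (hne : w ≠ c :: T) (hT : w ∉ RightM T) :
    w <:+: T ∧ ∃ a, w ++ [a] <+: c :: T ∧ ¬ w ++ [a] <:+: T := by
  obtain ⟨-, ⟨a, b, hab, ha, hb⟩ | hs⟩ := hw
  · rw [substr_iff_isInfix, List.infix_cons_iff] at ha hb
    have infix_of (d : α) (hd : w ++ [d] <:+: T) : w <:+: T :=
      (List.prefix_append w [d]).isInfix.trans hd
    by_cases ha' : w ++ [a] <:+: T
    · by_cases hb' : w ++ [b] <:+: T
      · exact absurd ⟨substr_iff_isInfix.2 (infix_of a ha'), Or.inl ⟨a, b, hab,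
          substr_iff_isInfix.2 ha', substr_iff_isInfix.2 hb'⟩⟩ hT
      · exact ⟨infix_of a ha', b, hb.resolve_right hb', hb'⟩
    · refine ⟨infix_of b (hb.resolve_left fun hb' => ?_), a, ha.resolve_right ha', ha'⟩
      have h := (List.prefix_of_prefix_length_le (ha.resolve_right ha') hb' (by simp)).eq_of_length
        (by simp)
      exact hab (by simpa using h)
  · rcases List.suffix_cons_iff.1 hs with h | h
    · exact absurd h hne
    · exact absurd (mem_rightM_of_isSuffix h) hT

theorem length_le_of_mem_rightM_cons {α : Type*} {c : α} {T v w : List α}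
    (hv : v ∈ RightM (c :: T)) (hvc : v ≠ c :: T) (hvT : v ∉ RightM T)
    (hw : w ∈ RightM (c :: T)) (hwc : w ≠ c :: T) (hwT : w ∉ RightM T) :
    v.length ≤ w.length := by
  obtain ⟨hvi, b, hb, -⟩ := exists_prefix_of_mem_rightM_cons hv hvc hvT
  obtain ⟨-, a, ha, ha'⟩ := exists_prefix_of_mem_rightM_cons hw hwc hwT
  by_contra! hlt
  refine ha' (List.IsInfix.trans (List.IsPrefix.isInfix ?_) hvi)
  exact List.prefix_of_prefix_length_le ha ((List.prefix_append v [b]).trans hb) (by simpa using hlt)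

theorem rightM_cons_subset {α : Type*} (c : α) (T : List α) :
    RightM (c :: T) ⊆ insert (c :: T) (RightM T) ∨
    ∃ h ∈ RightM (c :: T), h <+: c :: T ∧ 1 ≤ h.length ∧ h.length < T.length ∧
      RightM (c :: T) ⊆ insert (c :: T) (insert h (RightM T)) := by
  by_cases hE : ∃ h ∈ RightM (c :: T), h ≠ c :: T ∧ h ∉ RightM T
  · right
    obtain ⟨h, hh, hc, hT⟩ := hE
    obtain ⟨hi, a, ha, -⟩ := exists_prefix_of_mem_rightM_cons hh hc hT
    have hp : h <+: c :: T := (List.prefix_append h [a]).trans ha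
    refine ⟨h, hh, hp, ?_, ?_, fun w hw => ?_⟩
    · rw [Nat.one_le_iff_ne_zero, Ne, List.length_eq_zero_iff]
      rintro rfl
      exact hT (mem_rightM_of_isSuffix List.nil_suffix)
    · refine lt_of_le_of_ne hi.length_le fun hl => hT ?_
      rw [hi.eq_of_length hl]
      exact mem_rightM_of_isSuffix List.suffix_rfl
    · by_contra hcon
      simp only [Set.mem_insert_iff, not_or] at hcon
      obtain ⟨hwc, hwh, hwT⟩ := hcon
      obtain ⟨-, b, hb, -⟩ := exists_prefix_of_mem_rightM_cons hw hwc hwT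
      exact hwh ((List.prefix_of_prefix_length_le ((List.prefix_append w [b]).trans hb) hp
        (length_le_of_mem_rightM_cons hw hwc hwT hh hc hT)).eq_of_length
          (le_antisymm (length_le_of_mem_rightM_cons hw hwc hwT hh hc hT)
            (length_le_of_mem_rightM_cons hh hc hT hw hwc hwT)))
  · left
    push Not at hE
    intro w hw
    by_cases hwc : w = c :: T
    · exact Or.inl hwc
    · exact Or.inr (hE w hw hwc)

theorem ncard_rightM_cons_le {α : Type*} (c : α) (T : List α) :
    (RightM (c :: T)).ncard ≤ (RightM T).ncard + 1 ∨
    (RightM (c :: T)).ncard ≤ (RightM T).ncard + 2 ∧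
      ∃ k, 1 ≤ k ∧ k < T.length ∧ (c :: T).take k ∈ RightM (c :: T) := by
  rcases rightM_cons_subset c T with hs | ⟨h, hh, hp, h1, h2, hs⟩
  · left
    exact (Set.ncard_le_ncard hs ((rightM_finite T).insert _)).trans (Set.ncard_insert_le _ _)
  · right
    refine ⟨?_, h.length, h1, h2, List.prefix_iff_eq_take.1 hp ▸ hh⟩
    have hle := Set.ncard_le_ncard hs (((rightM_finite T).insert _).insert _)
    have := Set.ncard_insert_le (c :: T) (insert h (RightM T))
    have := Set.ncard_insert_le h (RightM T)
    omega

theorem ncard_rightM_le {α : Type*} (T : List α) :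
    (RightM T).ncard ≤ max (T.length + 1) (2 * T.length - 1) := by
  induction T with
  | nil =>
    have hs : RightM ([] : List α) ⊆ {[]} := fun w hw => by
      simpa using substr_iff_isInfix.1 hw.1
    simpa using Set.ncard_le_ncard hs
  | cons c T ih =>
    rw [List.length_cons]
    rcases ncard_rightM_cons_le c T with h | ⟨h, k, h1, h2, -⟩ <;> omega

/-- Each quasi-right-maximal string is the shortest suffix that is not right-maximal of some
prefix of `T`. -/
theorem ncard_quasiRightM_le {α : Type*} (T : List α) :
    (QuasiRightM T).ncard ≤ {k ∈ Set.Ico 1 T.length | T.take k ∉ RightM T}.ncard := by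
  have hex (q : List α) (hq : q ∈ QuasiRightM T) : ∃ k ≤ T.length, q <:+ T.take k := by
    obtain ⟨c, u, rfl, -, ⟨x, z, hT⟩, -⟩ := hq
    refine ⟨(x ++ c :: u).length, ?_, x, ?_⟩
    · rw [hT, List.length_append (bs := z)]
      omega
    · rw [hT, List.take_left]
  choose! f hfle hf using hex
  have hnot (q : List α) (hq : q ∈ QuasiRightM T) : T.take (f q) ∉ RightM T := fun h => by
    have hmem := mem_rightM_of_isSuffix_of_mem (hf q hq) h
    obtain ⟨c, u, rfl, -, -, hn⟩ := hq
    exact hn hmem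
  have hlen (q r : List α) (hq : q ∈ QuasiRightM T) (hr : r ∈ QuasiRightM T) (h : f q = f r) :
      r.length ≤ q.length := by
    by_contra! hlt
    have hqs := hf q hq
    have hrs := hf r hr
    obtain ⟨c, u, rfl, -, -, hn⟩ := hq
    obtain ⟨d, v, rfl, hv, -, -⟩ := hr
    rw [h] at hqs
    refine hn (mem_rightM_of_isSuffix_of_mem (List.suffix_of_suffix_length_le hqs
      ((List.suffix_cons d v).trans hrs) ?_) hv)
    simpa using hlt
  refine Set.ncard_le_ncard_of_injOn f (fun q hq => ⟨⟨?_, ?_⟩, hnot q hq⟩)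
    (fun q hq r hr h => ?_) ((Set.finite_Ico _ _).subset (Set.sep_subset _ _))
  · rw [Nat.one_le_iff_ne_zero]
    intro h0
    refine hnot q hq ?_
    rw [h0, List.take_zero]
    exact mem_rightM_of_isSuffix List.nil_suffix
  · refine lt_of_le_of_ne (hfle q hq) fun h => hnot q hq ?_
    rw [h, List.take_length]
    exact mem_rightM_of_isSuffix List.suffix_rfl
  · have hqs := hf q hq
    rw [h] at hqs
    exact (List.suffix_of_suffix_length_le hqs (hf r hr) (hlen r q hr hq h.symm)).eq_of_length
      (le_antisymm (hlen r q hr hq h.symm) (hlen q r hq hr h))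

theorem ncard_quasiRightM_le_sub_one {α : Type*} (T : List α) :
    (QuasiRightM T).ncard ≤ T.length - 1 := by
  refine (ncard_quasiRightM_le T).trans ?_
  refine (Set.ncard_le_ncard (Set.sep_subset _ _) (Set.finite_Ico _ _)).trans ?_
  simp [← Finset.coe_Ico, Set.ncard_coe_finset]

theorem ncard_quasiRightM_le_sub_two {α : Type*} {T : List α} {k : ℕ} (h1 : 1 ≤ k)
    (h2 : k < T.length) (hk : T.take k ∈ RightM T) :
    (QuasiRightM T).ncard ≤ T.length - 2 := by
  have hs : {k ∈ Set.Ico 1 T.length | T.take k ∉ RightM T} ⊆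
      ((Finset.Ico 1 T.length).erase k : Finset ℕ) := by
    rintro j ⟨hj, hjT⟩
    simp only [Finset.coe_erase, Finset.coe_Ico]
    refine ⟨hj, ?_⟩
    rintro rfl
    exact hjT hk
  refine (ncard_quasiRightM_le T).trans ((Set.ncard_le_ncard hs (Finset.finite_toSet _)).trans ?_)
  rw [Set.ncard_coe_finset, Finset.card_erase_of_mem (Finset.mem_Ico.2 ⟨h1, h2⟩), Nat.card_Ico]
  omega

theorem lst_size_bound {α : Type*} (T : List α) (n : ℕ) (hn : T.length = n) (h3 : 3 ≤ n) :
    (RightM T ∪ QuasiRightM T).ncard ≤ 3 * n - 3 ∧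
    (RightM T).ncard + (QuasiRightM T).ncard ≤ 3 * n - 3 := by
  have hsum : (RightM T).ncard + (QuasiRightM T).ncard ≤ 3 * n - 3 := by
    subst hn
    match T with
    | [] => simp at h3
    | c :: T =>
      have hR := ncard_rightM_le T
      have hQ := ncard_quasiRightM_le_sub_one (c :: T)
      rw [List.length_cons] at h3 hQ ⊢
      rcases ncard_rightM_cons_le c T with h | ⟨h, k, h1, h2, hk⟩
      · omega
      · have hQ' := ncard_quasiRightM_le_sub_two h1 (h2.trans (by simp)) hk
        rw [List.length_cons] at hQ'
        omega
  exact ⟨(Set.ncard_union_le _ _).trans hsum, hsum⟩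
end

section
/- Let T be a string of length n ≥ 2. Then the number of right-maximal substrings of T satisfies |RightM(T)| ≤ 2n − 1 (this is the number of nodes of the suffix tree of T, counting a node for every right-maximal substring including the empty string and all suffixes). -/
theorem mem_RightM {α : Type*} {T w : List α} :
    w ∈ RightM T ↔ (∃ a b : α, a ≠ b ∧ w ++ [a] <:+: T ∧ w ++ [b] <:+: T) ∨ w <:+ T := by
  simp only [RightM, Set.mem_ofPred_eq, substr_iff_isInfix]
  refine ⟨And.right, fun h => ⟨?_, h⟩⟩
  rcases h with ⟨a, _, _, ha, _⟩ | h
  · exact (List.prefix_append w [a]).isInfix.trans ha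
  · exact h.isInfix

/-- `w` occurs in `T`, and is the longest prefix of `c :: T` that does. -/
def IsLongestOldPrefix {α : Type*} (c : α) (T w : List α) : Prop :=
  w <:+: T ∧ ∃ a : α, w ++ [a] <+: c :: T ∧ ¬ w ++ [a] <:+: T

theorem IsLongestOldPrefix.length_le {α : Type*} {c : α} {T v w : List α}
    (hv : IsLongestOldPrefix c T v) (hw : IsLongestOldPrefix c T w) : v.length ≤ w.length := by
  by_contra! hlt
  obtain ⟨hvT, b, hb, _⟩ := hv
  obtain ⟨_, a, ha, hna⟩ := hw
  exact hna ((List.prefix_of_prefix_length_le ha ((List.prefix_append v [b]).trans hb)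
    (by simpa using hlt)).isInfix.trans hvT)

theorem IsLongestOldPrefix.eq {α : Type*} {c : α} {T v w : List α}
    (hv : IsLongestOldPrefix c T v) (hw : IsLongestOldPrefix c T w) : v = w := by
  have hlen := le_antisymm (hv.length_le hw) (hw.length_le hv)
  obtain ⟨_, b, hb, _⟩ := hv
  obtain ⟨_, a, ha, _⟩ := hw
  exact (List.prefix_of_prefix_length_le ((List.prefix_append v [b]).trans hb)
    ((List.prefix_append w [a]).trans ha) hlen.le).eq_of_length hlen

theorem mem_RightM_cons {α : Type*} {c : α} {T w : List α} (h : w ∈ RightM (c :: T)) :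
    w = c :: T ∨ IsLongestOldPrefix c T w ∨ w ∈ RightM T := by
  rw [mem_RightM] at h ⊢
  rcases h with ⟨a, b, hab, ha, hb⟩ | h
  · have old {d : α} (hd : w ++ [d] <:+: T) : w <:+: T :=
      (List.prefix_append w [d]).isInfix.trans hd
    rw [List.infix_cons_iff] at ha hb
    by_cases haT : w ++ [a] <:+: T <;> by_cases hbT : w ++ [b] <:+: T
    · exact .inr (.inr (.inl ⟨a, b, hab, haT, hbT⟩))
    · exact .inr (.inl ⟨old haT, b, hb.resolve_right hbT, hbT⟩)
    · exact .inr (.inl ⟨old hbT, a, ha.resolve_right haT, haT⟩)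
    · have := (List.prefix_of_prefix_length_le (ha.resolve_right haT) (hb.resolve_right hbT)
        (by simp)).eq_of_length (by simp)
      exact absurd (by simpa using this) hab
  · rcases List.suffix_cons_iff.1 h with h | h
    · exact .inl h
    · exact .inr (.inr (.inr h))

theorem exists_RightM_cons_subset {α : Type*} (c : α) (T : List α) :
    ∃ v, RightM (c :: T) ⊆ insert (c :: T) (insert v (RightM T)) := by
  by_cases h : ∃ v, IsLongestOldPrefix c T v
  · obtain ⟨v, hv⟩ := h
    refine ⟨v, fun w hw => ?_⟩
    rcases mem_RightM_cons hw with h | h | h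
    · exact .inl h
    · exact .inr (.inl (h.eq hv))
    · exact .inr (.inr h)
  · refine ⟨c :: T, fun w hw => ?_⟩
    rcases mem_RightM_cons hw with h' | h' | h'
    · exact .inl h'
    · exact absurd ⟨w, h'⟩ h
    · exact .inr (.inr h')

theorem RightM_pair_subset {α : Type*} (a b : α) :
    RightM [a, b] ⊆ {[], [b], [a, b]} := by
  intro w hw
  rw [mem_RightM] at hw
  rcases hw with ⟨x, y, hxy, hx, hy⟩ | h
  · have hlen : w.length + 1 ≤ 2 := by simpa using hx.length_le
    match w, hlen with
    | [], _ => simp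
    | [c], _ =>
      have hx' := hx.eq_of_length (by simp)
      have hy' := hy.eq_of_length (by simp)
      simp_all
  · simp only [List.suffix_cons_iff, List.suffix_nil] at h
    simp only [Set.mem_insert_iff, Set.mem_singleton_iff]
    tauto

theorem RightM_finite_and_ncard_le {α : Type*} {n : ℕ} (h2 : 2 ≤ n) :
    ∀ T : List α, T.length = n → (RightM T).Finite ∧ (RightM T).ncard ≤ 2 * n - 1 := by
  induction n, h2 using Nat.le_induction with
  | base =>
    intro T hT
    obtain ⟨a, b, rfl⟩ := List.length_eq_two.1 hT
    have hfin : ({[], [b], [a, b]} : Set (List α)).Finite := Set.toFinite _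
    refine ⟨hfin.subset (RightM_pair_subset a b),
      (Set.ncard_le_ncard (RightM_pair_subset a b) hfin).trans ?_⟩
    have h₁ := Set.ncard_insert_le [] ({[b], [a, b]} : Set (List α))
    have h₂ := Set.ncard_insert_le [b] ({[a, b]} : Set (List α))
    rw [Set.ncard_singleton] at h₂
    omega
  | succ n h2 ih =>
    intro T hT
    obtain ⟨c, T, rfl⟩ := List.exists_cons_of_length_eq_add_one hT
    obtain ⟨hfin, hcard⟩ := ih T (by simpa using hT)
    obtain ⟨v, hv⟩ := exists_RightM_cons_subset c T
    have hfin' := (hfin.insert v).insert (c :: T)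
    refine ⟨hfin'.subset hv, ?_⟩
    have h := Set.ncard_le_ncard hv hfin'
    have h₁ := Set.ncard_insert_le (c :: T) (insert v (RightM T))
    have h₂ := Set.ncard_insert_le v (RightM T)
    omega

theorem suffix_tree_size_bound {α : Type*} (T : List α) (n : ℕ) (hn : T.length = n) (h2 : 2 ≤ n) :
    (RightM T).ncard ≤ 2 * n - 1 :=
  (RightM_finite_and_ncard_le h2 T hn).2
end

section
/- Let T be a string of length n ≥ 1. Then |RightM(T)| + |{c : c is a character with the one-letter string c ∈ Substr(T) and c ∉ RightM(T)}| ≤ 2n. (This is the bound on the number of nodes of the simplified linear-size suffix trie simLSTrie(T), whose node set consists of the right-maximal substrings of T together with the non-right-maximal single characters occurring in T.) -/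
theorem Substr.cons {α : Type*} {T w : List α} (c : α) (h : Substr T w) : Substr (c :: T) w :=
  substr_iff_isInfix.2 ((substr_iff_isInfix.1 h).trans (List.suffix_cons c T).isInfix)

theorem Substr.of_isPrefix {α : Type*} {T v w : List α} (h : Substr T w) (hv : v <+: w) :
    Substr T v :=
  substr_iff_isInfix.2 (hv.isInfix.trans (substr_iff_isInfix.1 h))

theorem substr_cons_iff {α : Type*} {T w : List α} {c : α} :
    Substr (c :: T) w ↔ w <+: c :: T ∨ Substr T w := by
  simp only [substr_iff_isInfix, List.infix_cons_iff]

theorem rightM_subset_cons {α : Type*} (c : α) (T : List α) : RightM T ⊆ RightM (c :: T) := by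
  rintro w ⟨hw, ⟨a, b, hab, ha, hb⟩ | hs⟩
  · exact ⟨hw.cons c, Or.inl ⟨a, b, hab, ha.cons c, hb.cons c⟩⟩
  · exact ⟨hw.cons c, Or.inr (hs.trans (List.suffix_cons c T))⟩

theorem nil_mem_rightM {α : Type*} (T : List α) : [] ∈ RightM T :=
  ⟨⟨[], T, rfl⟩, Or.inr (List.nil_suffix)⟩

/-- The loci in the trie of `T` at which the string `S` leaves it. -/
def branchLocus {α : Type*} (T S : List α) : Set (List α) :=
  {u | Substr T u ∧ ∃ a, u ++ [a] <+: S ∧ ¬ Substr T (u ++ [a])}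

theorem branchLocus_subsingleton {α : Type*} (T S : List α) : (branchLocus T S).Subsingleton := by
  have length_le : ∀ u ∈ branchLocus T S, ∀ v ∈ branchLocus T S, v.length ≤ u.length := by
    rintro u ⟨-, a, hua, hna⟩ v ⟨hv, b, hvb, -⟩
    by_contra! hlt
    refine hna (hv.of_isPrefix ?_)
    exact List.prefix_of_prefix_length_le hua ((List.prefix_append v [b]).trans hvb)
      (by simpa using hlt)
  intro u hu v hv
  have hlen := le_antisymm (length_le v hv u hu) (length_le u hu v hv)
  obtain ⟨-, a, hua, -⟩ := hu
  obtain ⟨-, b, hvb, -⟩ := hv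
  exact (List.prefix_of_prefix_length_le ((List.prefix_append u [a]).trans hua)
    ((List.prefix_append v [b]).trans hvb) hlen.le).eq_of_length hlen

theorem branchLocus_cons_subset {α : Type*} {T : List α} {c : α} (hc : ¬ Substr T [c]) :
    branchLocus T (c :: T) ⊆ {[]} := by
  rintro u ⟨hu, a, hua, -⟩
  rcases u with _ | ⟨d, u⟩
  · rfl
  · obtain rfl : d = c := (List.cons_prefix_cons.1 hua).1
    exact absurd (hu.of_isPrefix ⟨u, rfl⟩) hc

theorem rightM_cons_subset_s2 {α : Type*} (c : α) (T : List α) :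
    RightM (c :: T) ⊆ insert (c :: T) (RightM T ∪ branchLocus T (c :: T)) := by
  have mem_branchLocus : ∀ {w : List α} {a b : α}, a ≠ b → w ++ [a] <+: c :: T →
      ¬ Substr T (w ++ [a]) → Substr (c :: T) (w ++ [b]) → w ∈ branchLocus T (c :: T) := by
    intro w a b hab ha hna hb
    refine ⟨?_, a, ha, hna⟩
    rcases substr_cons_iff.1 hb with hb | hb
    · have h := (List.prefix_of_prefix_length_le ha hb (by simp)).eq_of_length (by simp)
      exact absurd (by simpa using h) hab
    · exact hb.of_isPrefix (List.prefix_append w [b])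
  rintro w ⟨-, ⟨a, b, hab, ha, hb⟩ | hs⟩
  · by_cases hna : Substr T (w ++ [a])
    · by_cases hnb : Substr T (w ++ [b])
      · exact Or.inr (Or.inl ⟨hna.of_isPrefix (List.prefix_append w [a]),
          Or.inl ⟨a, b, hab, hna, hnb⟩⟩)
      · exact Or.inr (Or.inr (mem_branchLocus hab.symm
          ((substr_cons_iff.1 hb).resolve_right hnb) hnb ha))
    · exact Or.inr (Or.inr (mem_branchLocus hab
        ((substr_cons_iff.1 ha).resolve_right hna) hna hb))
  · rcases List.suffix_cons_iff.1 hs with h | h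
    · exact Or.inl h
    · exact Or.inr (Or.inl ⟨substr_iff_isInfix.2 h.isInfix, Or.inr h⟩)

theorem rightM_nil {α : Type*} : RightM ([] : List α) = {[]} := by
  refine Set.Subset.antisymm ?_ (Set.singleton_subset_iff.2 (nil_mem_rightM _))
  rintro w ⟨hw, -⟩
  exact List.infix_nil.1 (substr_iff_isInfix.1 hw)

/-- The characters occurring in `T` that are not right-maximal. -/
def nonRightMChars {α : Type*} (T : List α) : Set α :=
  {c | Substr T [c] ∧ [c] ∉ RightM T}

theorem nonRightMChars_finite {α : Type*} (T : List α) : (nonRightMChars T).Finite :=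
  T.finite_toSet.subset fun _ h =>
    (substr_iff_isInfix.1 h.1).subset (List.mem_singleton_self _)

theorem nonRightMChars_cons_subset {α : Type*} (c : α) (T : List α) :
    nonRightMChars (c :: T) ⊆ insert c (nonRightMChars T) := by
  rintro d ⟨hd, hn⟩
  rcases substr_cons_iff.1 hd with h | h
  · exact Or.inl (List.cons_prefix_cons.1 h).1
  · exact Or.inr ⟨h, fun hm => hn (rightM_subset_cons c T hm)⟩

theorem nonRightMChars_cons_subset_of_substr {α : Type*} {c : α} {T : List α}
    (hc : Substr T [c]) : nonRightMChars (c :: T) ⊆ nonRightMChars T := by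
  intro d hd
  rcases nonRightMChars_cons_subset c T hd with rfl | h
  · exact ⟨hc, fun hm => hd.2 (rightM_subset_cons d T hm)⟩
  · exact h

theorem ncard_rightM_add_ncard_nonRightMChars_cons_le {α : Type*} (c : α) (T : List α) :
    (RightM (c :: T)).ncard + (nonRightMChars (c :: T)).ncard ≤
      (RightM T).ncard + (nonRightMChars T).ncard + 2 := by
  have hB := branchLocus_subsingleton T (c :: T)
  by_cases hc : Substr T [c]
  · have hR := Set.ncard_le_ncard (rightM_cons_subset_s2 c T)
      (((rightM_finite T).union hB.finite).insert _)
    have hi := Set.ncard_insert_le (c :: T) (RightM T ∪ branchLocus T (c :: T))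
    have hu := Set.ncard_union_le (RightM T) (branchLocus T (c :: T))
    have hb := (Set.ncard_le_one hB.finite).2 fun _ hu _ hv => hB hu hv
    have hA := Set.ncard_le_ncard (nonRightMChars_cons_subset_of_substr hc)
      (nonRightMChars_finite T)
    omega
  · have hsub : RightM (c :: T) ⊆ insert (c :: T) (RightM T) := by
      have hBR : branchLocus T (c :: T) ⊆ RightM T := (branchLocus_cons_subset hc).trans
        (Set.singleton_subset_iff.2 (nil_mem_rightM T))
      simpa [Set.union_eq_self_of_subset_right hBR] using rightM_cons_subset_s2 c T
    have hR := Set.ncard_le_ncard hsub ((rightM_finite T).insert _)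
    have hi := Set.ncard_insert_le (c :: T) (RightM T)
    have hA := Set.ncard_le_ncard (nonRightMChars_cons_subset c T)
      ((nonRightMChars_finite T).insert _)
    have hj := Set.ncard_insert_le c (nonRightMChars T)
    omega

theorem ncard_rightM_singleton_add_le {α : Type*} (c : α) :
    (RightM [c]).ncard + (nonRightMChars [c]).ncard ≤ 2 := by
  have hnc : ¬ Substr [] [c] := by simp [substr_iff_isInfix]
  have hR : RightM [c] ⊆ {[c], []} := by
    have h := rightM_cons_subset_s2 c []
    rw [rightM_nil, Set.union_eq_self_of_subset_right (branchLocus_cons_subset hnc)] at h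
    exact h
  have hA : nonRightMChars [c] = ∅ := by
    refine Set.eq_empty_of_forall_notMem fun d ⟨hd, hn⟩ => hn ⟨hd, Or.inr ?_⟩
    have hdc : d = c := by
      simpa using (substr_iff_isInfix.1 hd).subset (List.mem_singleton_self d)
    rw [hdc]
  rw [hA, Set.ncard_empty, add_zero]
  have hi := Set.ncard_insert_le [c] {([] : List α)}
  rw [Set.ncard_singleton] at hi
  exact (Set.ncard_le_ncard hR (Set.toFinite _)).trans hi

theorem simLST_size_bound {α : Type*} (T : List α) (n : ℕ) (hn : T.length = n) (h1 : 1 ≤ n) :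
    (RightM T).ncard + {c : α | Substr T [c] ∧ [c] ∉ RightM T}.ncard ≤ 2 * n := by
  change (RightM T).ncard + (nonRightMChars T).ncard ≤ 2 * n
  subst hn
  induction T with
  | nil => simp at h1
  | cons c T ih =>
    rcases T with _ | ⟨d, T⟩
    · exact ncard_rightM_singleton_add_le c
    · have hstep := ncard_rightM_add_ncard_nonRightMChars_cons_le c (d :: T)
      have hT := ih (by simp)
      simp only [List.length_cons] at hT ⊢
      omega
end

section
/- Let T be a string of length n ≥ 1 all of whose characters are pairwise distinct. Then |RightM(T)| + |{c : c is a character with the one-letter string c ∈ Substr(T) and c ∉ RightM(T)}| = 2n. Hence the 2n upper bound on the number of nodes of the simplified linear-size suffix trie is tight. -/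
/-- In a duplicate-free list, an occurrence of a nonempty word determines the next letter. -/
theorem eq_of_substr_concat {α : Type*} {T w : List α} (hT : T.Nodup) (hw : w ≠ []) {a b : α}
    (ha : Substr T (w ++ [a])) (hb : Substr T (w ++ [b])) : a = b := by
  obtain ⟨x, z, hx⟩ := ha
  obtain ⟨y, t, hy⟩ := hb
  obtain ⟨v, c, rfl⟩ := List.eq_nil_or_concat' w |>.resolve_left hw
  have hx' : T = (x ++ v) ++ c :: (a :: z) := by simp [hx]
  have hy' : T = (y ++ v) ++ c :: (b :: t) := by simp [hy]
  have notMem : ∀ p q : List α, T = p ++ c :: q → c ∉ p ∧ c ∉ q := by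
    rintro p q rfl
    obtain ⟨-, hq, hpq⟩ := List.nodup_append.1 hT
    exact ⟨fun hc => hpq c hc c (by simp) rfl, (List.nodup_cons.1 hq).1⟩
  have h := (List.append_cons_inj_of_notMem (notMem _ _ hx').1 (notMem _ _ hx').2).1
    (hx'.symm.trans hy')
  simp only [List.cons.injEq] at h
  exact h.2.2.1

theorem mem_rightM_iff_isSuffix {α : Type*} {T w : List α} (hT : T.Nodup) :
    w ∈ RightM T ↔ w <:+ T := by
  refine ⟨?_, fun h => ⟨substr_iff_isInfix.2 h.isInfix, Or.inr h⟩⟩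
  rintro ⟨-, ⟨a, b, hab, ha, hb⟩ | h⟩
  · by_cases hw : w = []
    · exact hw ▸ List.nil_suffix
    · exact absurd (eq_of_substr_concat hT hw ha hb) hab
  · exact h

theorem ncard_setOf_isSuffix {α : Type*} (T : List α) :
    {w | w <:+ T}.ncard = T.length + 1 := by
  have h : {w | w <:+ T} = (fun i => T.drop i) '' (Finset.range (T.length + 1) : Set ℕ) := by
    ext w
    simp only [Set.mem_ofPred_eq, Set.mem_image, Finset.coe_range, Set.mem_Iio]
    constructor
    · exact fun hw => ⟨T.length - w.length, by omega, (List.suffix_iff_eq_drop.1 hw).symm⟩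
    · rintro ⟨i, -, rfl⟩
      exact List.drop_suffix i T
  rw [h, Set.InjOn.ncard_image, Set.ncard_coe_finset, Finset.card_range]
  intro i hi j hj hij
  have hlen := congrArg List.length hij
  simp only [Finset.coe_range, Set.mem_Iio, List.length_drop] at hi hj hlen
  omega

theorem List.Nodup.ncard_setOf_mem {α : Type*} {L : List α} (hL : L.Nodup) :
    {c | c ∈ L}.ncard = L.length := by
  classical
  rw [← List.coe_toFinset, Set.ncard_coe_finset, List.toFinset_card_of_nodup hL]

theorem simLST_size_tight {α : Type*} (T : List α) (n : ℕ) (hn : T.length = n) (h1 : 1 ≤ n)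
    (hdist : T.Nodup) :
    (RightM T).ncard + {c : α | Substr T [c] ∧ [c] ∉ RightM T}.ncard = 2 * n := by
  have hR : RightM T = {w | w <:+ T} := Set.ext fun w => mem_rightM_iff_isSuffix hdist
  have hne : T ≠ [] := by
    rintro rfl
    simp at hn
    omega
  obtain ⟨L, d, rfl⟩ := List.eq_nil_or_concat' T |>.resolve_left hne
  obtain ⟨hL, -, hd⟩ := List.nodup_append.1 hdist
  have hC : {c : α | Substr (L ++ [d]) [c] ∧ [c] ∉ RightM (L ++ [d])} = {c | c ∈ L} := by
    ext c
    have hs : [c] <:+ L ++ [d] ↔ c = d := by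
      simp [List.suffix_iff_eq_drop]
    simp only [Set.mem_ofPred_eq, substr_iff_isInfix, mem_rightM_iff_isSuffix hdist, hs,
      List.singleton_infix_iff, List.mem_append, List.mem_singleton]
    constructor
    · tauto
    · exact fun hc => ⟨Or.inl hc, hd c hc d (by simp)⟩
  rw [hC, hR, ncard_setOf_isSuffix, hL.ncard_setOf_mem]
  simp only [List.length_append, List.length_singleton] at hn ⊢
  omega
end

section
/- Let T be a string of length n in which at least two distinct characters occur, and let k be the number of nonempty suffixes s of T such that s·a ∈ Substr(T) for some character a. Then |RightM(T)| + |{c : c is a character with the one-letter string c ∈ Substr(T) and c ∉ RightM(T)}| ≤ 2n − k. -/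
theorem Substr.mem_of_append_singleton {α : Type*} {T w : List α} {a : α}
    (h : Substr T (w ++ [a])) : a ∈ T := by
  obtain ⟨x, z, h⟩ := h
  simp [h]

theorem Substr.suffix_or_extends {α : Type*} {T w : List α} (h : Substr T w) :
    w <:+ T ∨ ∃ a, Substr T (w ++ [a]) := by
  obtain ⟨x, z, h⟩ := h
  cases z with
  | nil => exact Or.inl ⟨x, by simp [h]⟩
  | cons a z => exact Or.inr ⟨a, x, z, by simp [h]⟩

open Classical in
/-- The characters by which an occurrence of `w` in `T` can be extended to the right. -/
noncomputable def rightExt {α : Type*} (T w : List α) : Finset α :=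
  T.toFinset.filter fun a => Substr T (w ++ [a])

theorem mem_rightExt {α : Type*} {T w : List α} {a : α} :
    a ∈ rightExt T w ↔ Substr T (w ++ [a]) := by
  simpa [rightExt] using Substr.mem_of_append_singleton

open Classical in
/-- The finite set of substrings of `T`. -/
noncomputable def substrFinset {α : Type*} (T : List α) : Finset (List α) :=
  T.sublists.toFinset.filter (Substr T)

theorem mem_substrFinset {α : Type*} {T w : List α} : w ∈ substrFinset T ↔ Substr T w := by
  simp only [substrFinset, Finset.mem_filter, List.mem_toFinset, List.mem_sublists,
    and_iff_right_iff_imp]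
  rintro ⟨x, z, h⟩
  exact List.IsInfix.sublist ⟨x, z, h.symm⟩

open Classical in
theorem sum_card_rightExt_le {α : Type*} (T : List α) :
    ∑ w ∈ substrFinset T, (rightExt T w).card ≤ ((substrFinset T).erase []).card := by
  rw [← Finset.card_sigma]
  refine Finset.card_le_card_of_injOn (fun p => p.1 ++ [p.2]) ?_ ?_
  · rintro ⟨w, a⟩ h
    simp only [Finset.coe_sigma, Set.mem_sigma_iff, Finset.mem_coe, mem_rightExt] at h
    simpa [mem_substrFinset] using h.2
  · rintro ⟨w, a⟩ - ⟨v, b⟩ - h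
    obtain ⟨rfl, h⟩ := List.append_inj' h rfl
    simp_all

open Classical in
/-- Leaf counting in the suffix trie: the root has `(rightExt T []).card` children, and every
other branching node contributes at least one further leaf. -/
theorem card_rightExt_nil_add_card_branching_le {α : Type*} (T : List α) :
    (rightExt T []).card
        + (((substrFinset T).erase []).filter fun w => 1 < (rightExt T w).card).card
      ≤ (((substrFinset T).erase []).filter fun w => rightExt T w = ∅).card := by
  have hsum := sum_card_rightExt_le T
  have hnil : [] ∈ substrFinset T := mem_substrFinset.2 ⟨[], T, by simp⟩
  rw [← Finset.add_sum_erase _ _ hnil] at hsum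
  have hle : ∑ w ∈ (substrFinset T).erase [], (1 + if 1 < (rightExt T w).card then 1 else 0)
      ≤ ∑ w ∈ (substrFinset T).erase [],
        ((rightExt T w).card + if rightExt T w = ∅ then 1 else 0) := by
    refine Finset.sum_le_sum fun w _ => ?_
    have := Finset.card_eq_zero (s := rightExt T w)
    split_ifs <;> grind
  simp only [Finset.sum_add_distrib, Finset.sum_const, smul_eq_mul, mul_one,
    ← Finset.card_filter] at hle
  omega

open Classical in
theorem card_tails_toFinset_erase_nil_le {α : Type*} (T : List α) :
    (T.tails.toFinset.erase []).card ≤ T.length := by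
  rw [Finset.card_erase_of_mem (by simp)]
  have := List.toFinset_card_le T.tails
  rw [List.length_tails] at this
  omega

open Classical in
theorem ncard_rightM_le_s7 {α : Type*} (T : List α) :
    (RightM T).ncard
      ≤ (((substrFinset T).erase []).filter fun w => 1 < (rightExt T w).card).card
        + (T.length + 1) := by
  have hsub : RightM T ⊆
      ↑((((substrFinset T).erase []).filter fun w => 1 < (rightExt T w).card)
        ∪ T.tails.toFinset) := by
    rintro w ⟨hw, ⟨a, b, hab, ha, hb⟩ | hsuf⟩
    · have : 1 < (rightExt T w).card :=
        Finset.one_lt_card.2 ⟨a, mem_rightExt.2 ha, b, mem_rightExt.2 hb, hab⟩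
      by_cases h : w = []
      · simp [h]
      · simp [h, mem_substrFinset, hw, this]
    · simp [hsuf]
  refine (Set.ncard_le_ncard hsub (Finset.finite_toSet _)).trans ?_
  rw [Set.ncard_coe_finset]
  refine (Finset.card_union_le _ _).trans ?_
  have := List.toFinset_card_le T.tails
  rw [List.length_tails] at this
  omega

theorem ncard_singleton_notMem_rightM_lt {α : Type*} {T : List α} (hT : T ≠ []) :
    {c : α | Substr T [c] ∧ [c] ∉ RightM T}.ncard < (rightExt T []).card := by
  rw [← Set.ncard_coe_finset]
  have hlast : Substr T [T.getLast hT] :=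
    ⟨T.dropLast, [], by simp [List.dropLast_append_getLast]⟩
  refine Set.ncard_lt_ncard ⟨fun c hc => ?_, fun h => ?_⟩ (Finset.finite_toSet _)
  · simpa [mem_rightExt] using hc.1
  · refine (h (show T.getLast hT ∈ _ by simpa [mem_rightExt] using hlast)).2 ⟨hlast, Or.inr ?_⟩
    exact ⟨T.dropLast, List.dropLast_append_getLast hT⟩

open Classical in
theorem card_leaves_add_ncard_extendable_suffixes_le {α : Type*} (T : List α) :
    (((substrFinset T).erase []).filter fun w => rightExt T w = ∅).card
        + {s : List α | s ≠ [] ∧ s <:+ T ∧ ∃ a : α, Substr T (s ++ [a])}.ncard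
      ≤ T.length := by
  have hK : {s : List α | s ≠ [] ∧ s <:+ T ∧ ∃ a : α, Substr T (s ++ [a])}
      = ↑((T.tails.toFinset.erase []).filter fun s => ∃ a : α, Substr T (s ++ [a])) := by
    ext s
    simp [and_assoc]
  rw [hK, Set.ncard_coe_finset]
  refine le_trans ?_ (card_tails_toFinset_erase_nil_le T)
  rw [← Finset.card_filter_add_card_filter_not (s := T.tails.toFinset.erase [])
    (fun s => ∃ a : α, Substr T (s ++ [a])), add_comm]
  refine Nat.add_le_add_left (Finset.card_le_card fun w hw => ?_) _
  simp only [Finset.mem_filter, Finset.mem_erase, mem_substrFinset,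
    Finset.eq_empty_iff_forall_notMem, mem_rightExt, List.mem_toFinset, List.mem_tails] at hw ⊢
  obtain ⟨⟨hne, hw⟩, hleaf⟩ := hw
  have hno : ¬ ∃ a, Substr T (w ++ [a]) := fun ⟨a, ha⟩ => hleaf a ha
  exact ⟨⟨hne, hw.suffix_or_extends.resolve_right hno⟩, hno⟩

theorem simLST_size_bound_with_k {α : Type*} (T : List α) (n : ℕ)
    (hn : T.length = n)
    (htwo : ∃ a b : α, a ∈ T ∧ b ∈ T ∧ a ≠ b) :
    (RightM T).ncard
      + {c : α | Substr T [c] ∧ [c] ∉ RightM T}.ncard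
      + {s : List α | s ≠ [] ∧ s <:+ T ∧ ∃ a : α, Substr T (s ++ [a])}.ncard
      ≤ 2 * n := by
  classical
  obtain ⟨a, -, ha, -⟩ := htwo
  have hbranch := card_rightExt_nil_add_card_branching_le T
  have hright := ncard_rightM_le_s7 T
  have hchar := ncard_singleton_notMem_rightM_lt (List.ne_nil_of_mem ha)
  have hleaves := card_leaves_add_ncard_extendable_suffixes_le T
  omega
end

section
/- Let T be a nonempty string and let σ_T be the number of distinct characters occurring in T. Then the one-letter string formed by the last character of T is right-maximal in T, and consequently |{c : c is a character with the one-letter string c ∈ Substr(T) and c ∉ RightM(T)}| ≤ σ_T − 1 (i.e. the simplified linear-size suffix trie has at most σ_T − 1 type-2 nodes). -/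
theorem Substr.of_isSuffix {α : Type*} {T w : List α} (h : w <:+ T) : Substr T w := by
  obtain ⟨x, rfl⟩ := h
  exact ⟨x, [], by simp⟩

theorem Substr.subset {α : Type*} {T w : List α} (h : Substr T w) : w ⊆ T := by
  obtain ⟨x, z, rfl⟩ := h
  intro c hc
  simp [hc]

theorem last_char_right_maximal {α : Type*} [DecidableEq α] (T : List α) (hne : T ≠ []) :
    [T.getLast hne] ∈ RightM T ∧
    {c : α | Substr T [c] ∧ [c] ∉ RightM T}.ncard ≤ T.toFinset.card - 1 := by
  have hlast : [T.getLast hne] ∈ RightM T :=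
    mem_rightM_of_isSuffix ⟨T.dropLast, List.dropLast_append_getLast hne⟩
  refine ⟨hlast, ?_⟩
  rw [← Finset.card_erase_of_mem (List.mem_toFinset.2 (List.getLast_mem hne)),
    ← Set.ncard_coe_finset]
  refine Set.ncard_le_ncard ?_ (Finset.finite_toSet _)
  rintro c ⟨hc, hnot⟩
  refine Finset.mem_coe.2 (Finset.mem_erase.2 ⟨?_, List.mem_toFinset.2 (hc.subset (by simp))⟩)
  rintro rfl
  exact hnot hlast
end

section
/- Fix k ≥ 1 and consider the string S_k over the alphabet ℕ defined as S_k = b̄₁ · ∏_{i=1}^{k} (1·2⋯i · b̄_{i+1}), where the digit characters are 1, …, k and the barred character b̄_j is encoded as k + j for j = 1, …, k+1; that is, S_k = [k+1] ++ (concatenation over i = 1, …, k of [1, 2, …, i] ++ [k+1+i]). Then the set of maximal substrings of S_k is exactly M(S_k) = {ε} ∪ { [1, 2, …, i] : 1 ≤ i ≤ k − 1 } ∪ {S_k}. -/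
def LeftM {α : Type*} (T : List α) : Set (List α) :=
  {w | Substr T w ∧ ((∃ a b : α, a ≠ b ∧ Substr T (a :: w) ∧ Substr T (b :: w)) ∨ w <+: T)}

def MaxSub {α : Type*} (T : List α) : Set (List α) := LeftM T ∩ RightM T

def Sk (k : ℕ) : List ℕ :=
  (k + 1) :: ((List.range k).map (fun i => ((List.range (i + 1)).map (· + 1)) ++ [k + 2 + i])).flatten

/-- The prefix of `Sk k` that ends after its first `m` blocks. -/
def SkInit (k m : ℕ) : List ℕ :=
  (k + 1) :: ((List.range m).map (fun i => ((List.range (i + 1)).map (· + 1)) ++ [k + 2 + i])).flatten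

theorem SkInit_succ (k m : ℕ) :
    SkInit k (m + 1) = SkInit k m ++ (List.range (m + 1)).map (· + 1) ++ [k + 2 + m] := by
  unfold SkInit
  rw [List.range_succ (n := m), List.map_append (l₂ := [m]), List.flatten_append]
  simp [List.range_succ]

theorem exists_SkInit_eq (k m : ℕ) : ∃ l, SkInit k m = l ++ [k + 1 + m] := by
  cases m with
  | zero => exact ⟨[], by simp [SkInit]⟩
  | succ m => exact ⟨_, by rw [SkInit_succ, show k + 1 + (m + 1) = k + 2 + m by omega]⟩

theorem SkInit_prefix_of_le (k m n : ℕ) (h : m ≤ n) : SkInit k m <+: SkInit k n := by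
  induction n, h using Nat.le_induction with
  | base => exact List.prefix_rfl
  | succ n _ ih =>
    refine ih.trans ?_
    rw [SkInit_succ, List.append_assoc]
    exact List.prefix_append _ _

theorem Substr_block (k m : ℕ) (h : m < k) :
    Substr (Sk k) ([k + 1 + m] ++ (List.range (m + 1)).map (· + 1) ++ [k + 2 + m]) := by
  obtain ⟨l, hl⟩ := exists_SkInit_eq k m
  obtain ⟨z, hz⟩ := SkInit_prefix_of_le k (m + 1) k h
  refine ⟨l, z, ?_⟩
  change SkInit k k = _
  rw [← hz, SkInit_succ, hl]
  simp

theorem Substr.mono {α : Type*} {T u v : List α} (h : Substr T u) (hv : v <:+: u) :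
    Substr T v := by
  obtain ⟨x, z, rfl⟩ := h
  obtain ⟨s, t, rfl⟩ := hv
  exact ⟨x ++ s, t ++ z, by simp⟩

theorem List.IsChain.of_Substr {α : Type*} {R : α → α → Prop} {T u : List α}
    (hT : T.IsChain R) (h : Substr T u) : u.IsChain R := by
  obtain ⟨x, z, rfl⟩ := h
  exact hT.left_of_append.right_of_append

theorem count_map_range (c n : ℕ) :
    ((List.range n).map (· + 1)).count c = if 1 ≤ c ∧ c ≤ n then 1 else 0 := by
  induction n with
  | zero => simp; omega
  | succ n ih =>
    rw [List.range_succ, List.map_append, List.count_append, ih]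
    simp only [List.map_cons, List.map_nil, List.count_singleton, beq_iff_eq]
    split_ifs <;> omega

theorem count_SkInit (k m c : ℕ) (hm : m ≤ k) (hc : k ≤ c) (hk : 1 ≤ k) :
    (SkInit k m).count c =
      if (c = k ∧ m = k) ∨ (k < c ∧ c ≤ k + 1 + m) then 1 else 0 := by
  induction m with
  | zero =>
    simp only [SkInit, List.range_zero, List.map_nil, List.flatten_nil, List.count_singleton,
      beq_iff_eq]
    split_ifs <;> omega
  | succ m ih =>
    rw [SkInit_succ, List.count_append, List.count_append, ih (by omega), count_map_range]
    simp only [List.count_singleton, beq_iff_eq]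
    split_ifs <;> omega

theorem count_Sk_le_one (k c : ℕ) (hc : k ≤ c) (hk : 1 ≤ k) : (Sk k).count c ≤ 1 := by
  change (SkInit k k).count c ≤ 1
  rw [count_SkInit k k c le_rfl hc hk]
  split_ifs <;> omega

/-- In `Sk k`, a digit `b` is preceded by `b - 1`, or by a barred character if `b = 1`. -/
def SkStep (k a b : ℕ) : Prop := b ≤ k → (b = 1 ∧ k < a) ∨ a + 1 = b

theorem isChain_SkInit (k m : ℕ) : (SkInit k m).IsChain (SkStep k) := by
  induction m with
  | zero => simp [SkInit]
  | succ m ih =>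
    have hr : ((List.range (m + 1)).map (· + 1)).IsChain (SkStep k) := by
      rw [List.isChain_map, List.isChain_range]
      exact fun _ _ _ => Or.inr rfl
    obtain ⟨l, hl⟩ := exists_SkInit_eq k m
    rw [SkInit_succ]
    refine (ih.append hr ?_).append (List.isChain_singleton _) ?_
    · intro a ha b hb _
      rw [hl] at ha
      simp [List.range_succ_eq_map] at ha hb
      omega
    · intro a _ b hb h
      simp at hb
      omega

theorem append_cons_inj_of_count_le_one {α : Type*} [DecidableEq α] {c : α} {x z x' z' : List α}
    (h : x ++ c :: z = x' ++ c :: z') (hc : (x ++ c :: z).count c ≤ 1) : x = x' ∧ z = z' := by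
  have hx : c ∉ x := by
    intro hx
    have := List.count_pos_iff.2 hx
    simp at hc
    omega
  have hx' : c ∉ x' := by
    intro hx
    have := List.count_pos_iff.2 hx
    rw [h] at hc
    simp at hc
    omega
  clear hc
  induction x generalizing x' with
  | nil =>
    cases x' with
    | nil => simpa using h
    | cons b x' => simp at h; simp [h.1] at hx'
  | cons a x ih =>
    cases x' with
    | nil => simp at h; simp [h.1] at hx
    | cons b x' =>
      simp only [List.cons_append, List.cons.injEq] at h
      have := ih h.2 (by simp_all) (by simp_all)
      simp_all

theorem occurrence_unique {α : Type*} [DecidableEq α] {T w x z x' z' : List α} {c : α}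
    (hT : T.count c ≤ 1) (hc : c ∈ w) (h : T = x ++ w ++ z) (h' : T = x' ++ w ++ z') :
    x = x' ∧ z = z' := by
  obtain ⟨s, t, rfl⟩ := List.append_of_mem hc
  have e : (x ++ s) ++ c :: (t ++ z) = (x' ++ s) ++ c :: (t ++ z') := by
    simpa using h.symm.trans h'
  have := append_cons_inj_of_count_le_one e (by rw [h] at hT; simpa using hT)
  simpa using this

theorem eq_of_mem_MaxSub {α : Type*} [DecidableEq α] {T w : List α} {c : α}
    (hT : T.count c ≤ 1) (hc : c ∈ w) (hw : w ∈ MaxSub T) : w = T := by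
  obtain ⟨⟨_, hl⟩, ⟨_, hr⟩⟩ := hw
  rcases hl with ⟨a, b, hab, ⟨x, z, h⟩, ⟨x', z', h'⟩⟩ | ⟨z, hz⟩
  · have := (occurrence_unique (x := x ++ [a]) (z := z) (x' := x' ++ [b]) (z' := z') hT hc
      (by simpa using h) (by simpa using h')).1
    simp_all
  rcases hr with ⟨a, b, hab, ⟨x, z, h⟩, ⟨x', z', h'⟩⟩ | ⟨x, hx⟩
  · have := (occurrence_unique (x := x) (z := a :: z) (x' := x') (z' := b :: z') hT hc
      (by simpa using h) (by simpa using h')).2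
    simp_all
  · have := (occurrence_unique (x := []) (z := z) (x' := x) (z' := []) hT hc
      (by simpa using hz.symm) (by simpa using hx.symm)).2
    simp_all

theorem eq_map_range_of_isChain {k n : ℕ} {l : List ℕ} (hc : (n :: l).IsChain (SkStep k))
    (hlt : ∀ c ∈ n :: l, c < k) :
    n :: l = (List.range (l.length + 1)).map (n + ·) := by
  induction l generalizing n with
  | nil => simp
  | cons b l ih =>
    rw [List.isChain_cons_cons] at hc
    have hn := hlt n (by simp)
    have hb := hlt b (by simp)
    have hnb : n + 1 = b := by
      rcases hc.1 hb.le with h | h <;> omega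
    rw [List.length_cons, List.range_succ_eq_map (n := l.length + 1),
      ih hc.2 (fun c h => hlt c (List.mem_cons_of_mem _ h))]
    subst hnb
    simp [Function.comp_def]
    intros; omega

theorem maxSub_Sk (k : ℕ) (hk : 1 ≤ k) :
    MaxSub (Sk k) =
      {([] : List ℕ)} ∪
      {w : List ℕ | ∃ i : ℕ, 1 ≤ i ∧ i ≤ k - 1 ∧ w = (List.range i).map (· + 1)} ∪
      {Sk k} := by
  have hchain : (Sk k).IsChain (SkStep k) := isChain_SkInit k k
  ext w
  constructor
  · intro hw
    by_cases hc : ∃ c ∈ w, k ≤ c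
    · obtain ⟨c, hc, hkc⟩ := hc
      exact Or.inr (eq_of_mem_MaxSub (count_Sk_le_one k c hkc hk) hc hw)
    push Not at hc
    left
    cases w with
    | nil => exact Or.inl rfl
    | cons n l =>
      right
      obtain ⟨⟨hs, hl⟩, -⟩ := hw
      have hn := hc n (by simp)
      have h1 : n = 1 := by
        rcases hl with ⟨a, b, hab, ha, hb⟩ | ⟨z, hz⟩
        · have ha := (List.isChain_cons_cons.1 (hchain.of_Substr ha)).1 hn.le
          have hb := (List.isChain_cons_cons.1 (hchain.of_Substr hb)).1 hn.le
          omega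
        · simp only [Sk, List.cons_append, List.cons.injEq] at hz
          omega
      have he := eq_map_range_of_isChain (hchain.of_Substr hs) hc
      refine ⟨l.length + 1, by omega, ?_, ?_⟩
      · have := hc (n + l.length) (by rw [he]; simp)
        omega
      · rw [he, h1]
        simp [Nat.add_comm]
  · rintro ((rfl | ⟨i, hi, hik, rfl⟩) | rfl)
    · have : Substr (Sk k) [] := ⟨[], Sk k, rfl⟩
      exact ⟨⟨this, Or.inr ⟨Sk k, rfl⟩⟩, ⟨this, Or.inr List.nil_suffix⟩⟩
    · obtain ⟨m, rfl⟩ : ∃ m, i = m + 1 := ⟨i - 1, by omega⟩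
      have h₁ := Substr_block k m (by omega)
      have h₂ := Substr_block k (m + 1) (by omega)
      rw [List.range_succ (n := m + 1), List.map_append] at h₂
      have hs := h₁.mono (v := (List.range (m + 1)).map (· + 1)) ⟨_, _, rfl⟩
      refine ⟨⟨hs, Or.inl ⟨k + 1 + m, k + 1 + (m + 1), by omega, h₁.mono ⟨[], _, rfl⟩,
        h₂.mono ⟨[], [m + 1 + 1, k + 2 + (m + 1)], by simp⟩⟩⟩,
        ⟨hs, Or.inl ⟨k + 2 + m, m + 1 + 1, by omega, h₁.mono ⟨[k + 1 + m], [], by simp⟩,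
        h₂.mono ⟨[k + 1 + (m + 1)], [k + 2 + (m + 1)], by simp⟩⟩⟩⟩
    · have : Substr (Sk k) (Sk k) := ⟨[], [], by simp⟩
      exact ⟨⟨this, Or.inr List.prefix_rfl⟩, ⟨this, Or.inr List.suffix_rfl⟩⟩
end

section
/- Fix k ≥ 2 and let S_k = [k+1] ++ (concatenation over i = 1, …, k of [1, 2, …, i] ++ [k+1+i]) be the string over ℕ with digits 1, …, k and barred characters b̄_j = k + j. For every i with 1 ≤ i ≤ k − 1, the set of right-extensions of the maximal substring [1, 2, …, i] is exactly the two-element set { c : [1, 2, …, i]·c ∈ Substr(S_k) } = { i+1, k+1+i }. -/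
theorem substr_iff_infix {α : Type*} (T w : List α) : Substr T w ↔ w <:+: T :=
  ⟨fun ⟨x, z, h⟩ => ⟨x, z, h.symm⟩, fun ⟨x, z, h⟩ => ⟨x, z, h.symm⟩⟩

theorem map_range_succ_append (i c : ℕ) :
    ((List.range (i + 1)).map (· + 1)) ++ [c] = ((List.range i).map (· + 1)) ++ [i + 1, c] := by
  simp [List.range_succ]

/-- The block `[1, …, i + 1, k + 2 + i]` with `i < k` is an infix of `Sk k`. -/
theorem block_infix_Sk {k i : ℕ} (hi : i < k) :
    ((List.range (i + 1)).map (· + 1)) ++ [k + 2 + i] <:+: Sk k := by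
  refine List.IsInfix.trans ?_ (List.suffix_cons _ _).isInfix
  exact List.infix_of_mem_flatten (List.mem_map.2 ⟨i, List.mem_range.2 hi, rfl⟩)

/-- In `Sk k` every digit `a ≤ k` is followed by `a + 1` or by `k + 1 + a`. -/
theorem isChain_Sk (k : ℕ) :
    (Sk k).IsChain (fun a b => a ≤ k → b = a + 1 ∨ b = k + 1 + a) := by
  have block (i : ℕ) : (((List.range (i + 1)).map (· + 1)) ++ [k + 2 + i]).IsChain
      (fun a b => a ≤ k → b = a + 1 ∨ b = k + 1 + a) := by
    refine List.isChain_append.2 ⟨?_, by simp, ?_⟩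
    · rw [List.isChain_map]
      exact (List.isChain_range _ _).2 (by intros; omega)
    · simp [List.range_succ]
      omega
  refine List.isChain_cons.2 ⟨fun _ _ h => by omega, ?_⟩
  rw [List.isChain_flatten (by simp)]
  refine ⟨by simpa using fun i _ => block i, ?_⟩
  rw [List.isChain_map]
  refine List.Pairwise.isChain (List.pairwise_of_forall fun i j x hx y _ h => ?_)
  simp at hx
  omega

theorem right_extensions_Sk (k : ℕ) (hk : 2 ≤ k) (i : ℕ) (hi1 : 1 ≤ i) (hik : i ≤ k - 1) :
    {c : ℕ | Substr (Sk k) (((List.range i).map (· + 1)) ++ [c])} = {i + 1, k + 1 + i} := by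
  ext c
  simp only [Set.mem_ofPred_eq, Set.mem_insert_iff, Set.mem_singleton_iff, substr_iff_infix]
  obtain ⟨j, rfl⟩ : ∃ j, i = j + 1 := ⟨i - 1, by omega⟩
  constructor
  · intro h
    rw [map_range_succ_append] at h
    have hpair := (isChain_Sk k).infix ((List.suffix_append _ _).isInfix.trans h)
    exact List.isChain_pair.1 hpair (by omega)
  · rintro (rfl | rfl)
    · refine List.IsInfix.trans ?_ (block_infix_Sk (k := k) (i := j + 1) (by omega))
      refine ⟨[], [k + 2 + (j + 1)], ?_⟩
      simp [List.range_succ]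
    · have h := block_infix_Sk (k := k) (i := j) (by omega)
      rwa [show k + 2 + j = k + 1 + (j + 1) by omega] at h
end

section
/- Fix k ≥ 1 and let S_k = [k+1] ++ (concatenation over i = 1, …, k of [1, 2, …, i] ++ [k+1+i]) be the string over ℕ with digits 1, …, k and barred characters b̄_j = k + j. Then e_R(S_k) = 4k − 1. -/
noncomputable def eR {α : Type*} (T : List α) : ℕ :=
  {p : List α × α | p.1 ∈ MaxSub T ∧ Substr T (p.1 ++ [p.2])}.ncard

/-- The concatenation of the leading barred character and the first `n` blocks of `Sk k`. -/
def blocks (k n : ℕ) : List ℕ :=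
  (k + 1) :: ((List.range n).map
    (fun i => ((List.range (i + 1)).map (· + 1)) ++ [k + 2 + i])).flatten

theorem blocks_succ (k n : ℕ) :
    blocks k (n + 1) = blocks k n ++ (List.range' 1 (n + 1) ++ [k + 2 + n]) := by
  have h : (List.range (n + 1)).map (· + 1) = List.range' 1 (n + 1) := by
    rw [List.range'_eq_map_range]
    exact List.map_congr_left fun a _ => Nat.add_comm a 1
  unfold blocks
  rw [List.range_succ (n := n), List.map_append, List.flatten_append, ← h]
  simp

theorem exists_blocks_eq_append (k n : ℕ) : ∃ A, blocks k n = A ++ [k + 1 + n] := by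
  cases n with
  | zero => exact ⟨[], rfl⟩
  | succ n =>
    refine ⟨blocks k n ++ List.range' 1 (n + 1), ?_⟩
    rw [blocks_succ, List.append_assoc, show k + 2 + n = k + 1 + (n + 1) by omega]

theorem block_isInfix_blocks (k : ℕ) {n i : ℕ} (hi : i < n) :
    (k + 1 + i) :: (List.range' 1 (i + 1) ++ [k + 2 + i]) <:+: blocks k n := by
  induction n with
  | zero => omega
  | succ n ih =>
    rw [blocks_succ]
    rcases Nat.lt_succ_iff_lt_or_eq.mp hi with h | rfl
    · exact (ih h).trans (List.prefix_append _ _).isInfix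
    · obtain ⟨A, hA⟩ := exists_blocks_eq_append k i
      exact ⟨A, [], by rw [hA]; simp⟩

theorem bounds_of_mem_blocks {k n c : ℕ} (hn : n ≤ k) (hc : c ∈ blocks k n) :
    1 ≤ c ∧ c ≤ k + 1 + n := by
  induction n with
  | zero => simp [blocks] at hc; omega
  | succ n ih =>
    rw [blocks_succ] at hc
    simp only [List.mem_append, List.mem_range'_1, List.mem_singleton] at hc
    rcases hc with hc | hc | hc
    · have := ih (by omega) hc; omega
    · omega
    · omega

theorem count_blocks_le_one {k n c : ℕ} (hn : n ≤ k) (hc : k + 1 ≤ c) :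
    (blocks k n).count c ≤ 1 := by
  induction n with
  | zero => simpa [blocks] using List.count_le_length (a := c) (l := [k + 1])
  | succ n ih =>
    rw [blocks_succ, List.count_append, List.count_append]
    have h1 : (List.range' 1 (n + 1)).count c = 0 := by
      rw [List.count_eq_zero, List.mem_range'_1]; omega
    by_cases h : c = k + 2 + n
    · have h2 : (blocks k n).count c = 0 := by
        rw [List.count_eq_zero]
        intro hm
        have := bounds_of_mem_blocks (by omega) hm
        omega
      have := List.count_le_length (a := c) (l := [k + 2 + n])
      simp only [List.length_singleton] at this
      omega
    · have h3 : [k + 2 + n].count c = 0 := by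
        rw [List.count_eq_zero]; simpa using h
      have := ih (by omega)
      omega

/-- `Follows k a b` holds when `b` may come right after `a` in `Sk k`. -/
def Follows (k a b : ℕ) : Prop :=
  (k + 1 ≤ a ∧ b = 1) ∨ (1 ≤ a ∧ a < k ∧ b = a + 1) ∨ (1 ≤ a ∧ a ≤ k ∧ b = a + k + 1)

theorem isChain_blocks {k n : ℕ} (hn : n ≤ k) : (blocks k n).IsChain (Follows k) := by
  induction n with
  | zero => simp [blocks]
  | succ n ih =>
    obtain ⟨A, hA⟩ := exists_blocks_eq_append k n
    have hr : (List.range' 1 (n + 1) ++ [k + 2 + n]).IsChain (Follows k) := by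
      rw [List.isChain_append]
      refine ⟨?_, List.isChain_singleton _, ?_⟩
      · rw [List.isChain_iff_getElem]
        intro i hi
        simp only [List.length_range'] at hi
        simp only [List.getElem_range', Follows]
        omega
      · simp [List.getLast?_range', Follows]
        omega
    rw [blocks_succ, List.isChain_append]
    refine ⟨ih (by omega), hr, ?_⟩
    rw [hA]
    simp [List.range'_succ, Follows]
    omega

theorem eq_range'_of_isChain {k : ℕ} {w : List ℕ} {s : ℕ}
    (hw : (s :: w).IsChain (Follows k)) (hlt : ∀ c ∈ s :: w, c < k + 1) :
    s :: w = List.range' s (w.length + 1) := by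
  induction w generalizing s with
  | nil => simp
  | cons a w ih =>
    rw [List.isChain_cons_cons] at hw
    have hs := hlt s (by simp)
    have ha := hlt a (by simp)
    obtain rfl : a = s + 1 := by
      have := hw.1
      unfold Follows at this
      omega
    rw [ih hw.2 fun c hc => hlt c (List.mem_cons_of_mem _ hc), List.range'_succ (s := s)]
    simp

theorem append_inj_of_count_le_one {α : Type*} [DecidableEq α] {x w z x' z' : List α} {c : α}
    (hc : c ∈ w) (hcount : (x ++ w ++ z).count c ≤ 1) (h : x ++ w ++ z = x' ++ w ++ z') :
    z = z' := by
  have h1 : 1 ≤ w.count c := List.one_le_count_iff.mpr hc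
  obtain ⟨p, q, rfl⟩ := List.append_of_mem hc
  have e1 : x ++ (p ++ c :: q) ++ z = (x ++ p) ++ c :: (q ++ z) := by simp
  have e2 : x' ++ (p ++ c :: q) ++ z' = (x' ++ p) ++ c :: (q ++ z') := by simp
  have hcount' := hcount
  rw [h, e2] at hcount'
  rw [e1, e2] at h
  simp only [List.count_append, List.count_cons_self] at hcount'
  have hx : c ∉ x' ++ p := by
    rw [← List.count_eq_zero, List.count_append]; omega
  have hz : c ∉ q ++ z' := by
    rw [← List.count_eq_zero, List.count_append]; omega
  have := (List.append_cons_inj_of_notMem hx hz).mp h.symm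
  exact List.append_cancel_left this.2.2.symm

theorem count_ne_le_one_of_rightM {α : Type*} [DecidableEq α] {T w : List α} {c d : α}
    (hw : w ∈ RightM T) (hd : Substr T (w ++ [d])) (hc : c ∈ w) : ¬ T.count c ≤ 1 := by
  intro hcount
  obtain ⟨-, ⟨a, b, hab, ⟨x, z, hx⟩, ⟨x', z', hx'⟩⟩ | ⟨x, hx⟩⟩ := hw
  · have ha : T = x ++ w ++ (a :: z) := by simp [hx]
    have hb : T = x' ++ w ++ (b :: z') := by simp [hx']
    have := append_inj_of_count_le_one hc (ha ▸ hcount) (ha.symm.trans hb)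
    exact hab (List.cons.inj this).1
  · obtain ⟨x', z', hx'⟩ := hd
    have ha : T = x ++ w ++ [] := by simp [hx]
    have hb : T = x' ++ w ++ (d :: z') := by simp [hx']
    have := append_inj_of_count_le_one hc (ha ▸ hcount) (ha.symm.trans hb)
    simp at this

theorem nil_mem_maxSub {α : Type*} (T : List α) : [] ∈ MaxSub T :=
  ⟨⟨⟨[], T, by simp⟩, .inr ⟨T, rfl⟩⟩, ⟨⟨[], T, by simp⟩, .inr List.nil_suffix⟩⟩

theorem mem_Sk_iff {k c : ℕ} : c ∈ Sk k ↔ 1 ≤ c ∧ c ≤ 2 * k + 1 := by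
  change c ∈ blocks k k ↔ _
  constructor
  · intro h
    have := bounds_of_mem_blocks le_rfl h
    omega
  · rintro ⟨h1, h2⟩
    by_cases hck : c ≤ k
    · refine (block_isInfix_blocks k (show k - 1 < k by omega)).subset ?_
      simp only [List.mem_cons, List.mem_append, List.mem_range'_1]
      omega
    · by_cases hc : c = k + 1
      · simp [hc, blocks]
      · refine (block_isInfix_blocks k (show c - (k + 2) < k by omega)).subset ?_
        simp only [List.mem_cons, List.mem_append]
        omega

theorem substr_Sk_range'_append_succ {k m : ℕ} (hm : m < k) :
    Substr (Sk k) (List.range' 1 m ++ [m + 1]) := by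
  refine substr_iff_isInfix.mpr (List.IsInfix.trans ?_ (block_isInfix_blocks k hm))
  exact ⟨[k + 1 + m], [k + 2 + m], by rw [List.range'_1_concat, Nat.add_comm 1 m]; simp⟩

theorem substr_Sk_range'_append_barred {k m : ℕ} (h1 : 1 ≤ m) (hm : m ≤ k) :
    Substr (Sk k) (List.range' 1 m ++ [m + k + 1]) := by
  obtain ⟨m, rfl⟩ := Nat.exists_eq_add_of_le' h1
  refine substr_iff_isInfix.mpr (List.IsInfix.trans ?_ (block_isInfix_blocks k hm))
  exact ⟨[k + 1 + m], [], by simp; omega⟩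

theorem range'_mem_maxSub_Sk {k m : ℕ} (h1 : 1 ≤ m) (hm : m < k) :
    List.range' 1 m ∈ MaxSub (Sk k) := by
  have hb : Substr (Sk k) (List.range' 1 m) :=
    substr_iff_isInfix.mpr ((List.prefix_append _ _).isInfix.trans
      (substr_iff_isInfix.mp (substr_Sk_range'_append_succ hm)))
  refine ⟨⟨hb, .inl ⟨k + m, k + 1 + m, by omega, ?_, ?_⟩⟩,
    ⟨hb, .inl ⟨m + 1, m + k + 1, by omega, substr_Sk_range'_append_succ hm,
      substr_Sk_range'_append_barred h1 hm.le⟩⟩⟩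
  · obtain ⟨m, rfl⟩ := Nat.exists_eq_add_of_le' h1
    refine substr_iff_isInfix.mpr
      (List.IsInfix.trans ?_ (block_isInfix_blocks k (show m < k by omega)))
    exact ⟨[], [k + 2 + m], by simp; omega⟩
  · refine substr_iff_isInfix.mpr (List.IsInfix.trans ?_ (block_isInfix_blocks k hm))
    exact ⟨[], [m + 1, k + 2 + m], by rw [List.range'_1_concat, Nat.add_comm 1 m]; simp⟩

theorem exists_eq_range'_of_mem_maxSub_Sk {k c : ℕ} {w : List ℕ} (hne : w ≠ [])
    (hw : w ∈ MaxSub (Sk k)) (hc : Substr (Sk k) (w ++ [c])) :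
    ∃ m, 1 ≤ m ∧ m < k ∧ w = List.range' 1 m ∧ (c = m + 1 ∨ c = m + k + 1) := by
  have hchain : ∀ {v}, Substr (Sk k) v → v.IsChain (Follows k) := by
    rintro v ⟨x, z, h⟩
    have hT : (Sk k).IsChain (Follows k) := isChain_blocks le_rfl
    rw [h] at hT
    exact hT.left_of_append.right_of_append
  obtain ⟨hL, hR⟩ := hw
  have hdigit : ∀ d ∈ w, d < k + 1 := by
    intro d hd
    by_contra! hge
    exact count_ne_le_one_of_rightM hR hc hd (count_blocks_le_one le_rfl hge)
  obtain ⟨s, v, rfl⟩ := List.exists_cons_of_ne_nil hne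
  have hs := hdigit s (by simp)
  obtain rfl : s = 1 := by
    rcases hL.2 with ⟨a, b, hab, ha, hb⟩ | hpre
    · have h1 := (List.isChain_cons_cons.mp (hchain ha)).1
      have h2 := (List.isChain_cons_cons.mp (hchain hb)).1
      unfold Follows at h1 h2
      omega
    · have := (List.cons_prefix_cons.mp hpre).1
      omega
  have hv := eq_range'_of_isChain (hchain hL.1) hdigit
  generalize v.length = m at hv
  rw [hv] at hR hc hdigit ⊢
  have hlast : ∀ {a}, Substr (Sk k) (List.range' 1 (m + 1) ++ [a]) → Follows k (m + 1) a := by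
    intro a ha
    have h := hchain ha
    rw [List.isChain_append] at h
    refine h.2.2 (m + 1) ?_ a (by simp)
    simp [List.getLast?_range']
  refine ⟨m + 1, by omega, ?_, rfl, ?_⟩
  · rcases hR.2 with ⟨a, b, hab, ha, hb⟩ | ⟨x, hx⟩
    · have h1 := hlast ha
      have h2 := hlast hb
      unfold Follows at h1 h2
      have := hdigit (m + 1) (by rw [List.mem_range'_1]; omega)
      omega
    · obtain ⟨A, hA⟩ := exists_blocks_eq_append k k
      change _ = blocks k k at hx
      rw [hA, List.range'_1_concat, ← List.append_assoc] at hx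
      have := (List.append_inj' hx rfl).2
      have := hdigit (m + 1) (by rw [List.mem_range'_1]; omega)
      simp at *
      omega
  · have h1 := hlast hc
    have := hdigit (m + 1) (by rw [List.mem_range'_1]; omega)
    unfold Follows at h1
    omega

theorem rightExtensions_Sk (k : ℕ) :
    {p : List ℕ × ℕ | p.1 ∈ MaxSub (Sk k) ∧ Substr (Sk k) (p.1 ++ [p.2])} =
      ↑((Finset.Icc 1 (2 * k + 1)).image (fun c => (([] : List ℕ), c)) ∪
        ((Finset.Ico 1 k).image (fun m => (List.range' 1 m, m + 1)) ∪
          (Finset.Ico 1 k).image (fun m => (List.range' 1 m, m + k + 1)))) := by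
  ext ⟨w, c⟩
  simp only [Set.mem_ofPred_eq, Finset.coe_union, Finset.coe_image, Set.mem_union, Set.mem_image,
    Finset.mem_coe, Finset.mem_Icc, Finset.mem_Ico, Prod.mk.injEq]
  constructor
  · rintro ⟨hw, hc⟩
    by_cases hne : w = []
    · subst hne
      refine .inl ⟨c, mem_Sk_iff.mp ?_, rfl, rfl⟩
      exact (substr_iff_isInfix.mp hc).subset (by simp)
    · obtain ⟨m, h1, h2, rfl, rfl | rfl⟩ := exists_eq_range'_of_mem_maxSub_Sk hne hw hc
      · exact .inr (.inl ⟨m, ⟨h1, h2⟩, rfl, rfl⟩)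
      · exact .inr (.inr ⟨m, ⟨h1, h2⟩, rfl, rfl⟩)
  · rintro (⟨c, hc, rfl, rfl⟩ | ⟨m, ⟨h1, h2⟩, rfl, rfl⟩ | ⟨m, ⟨h1, h2⟩, rfl, rfl⟩)
    · obtain ⟨x, z, h⟩ := List.append_of_mem (mem_Sk_iff.mpr hc)
      exact ⟨nil_mem_maxSub _, x, z, by simp [h]⟩
    · exact ⟨range'_mem_maxSub_Sk h1 h2, substr_Sk_range'_append_succ h2⟩
    · exact ⟨range'_mem_maxSub_Sk h1 h2, substr_Sk_range'_append_barred h1 h2.le⟩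

theorem eR_Sk (k : ℕ) (hk : 1 ≤ k) : eR (Sk k) = 4 * k - 1 := by
  rw [eR, rightExtensions_Sk, Set.ncard_coe_finset, Finset.card_union_of_disjoint,
    Finset.card_union_of_disjoint, Finset.card_image_of_injective,
    Finset.card_image_of_injective, Finset.card_image_of_injective]
  · simp only [Nat.card_Icc, Nat.card_Ico]
    omega
  · intro a b h
    simpa using (Prod.mk.inj h).2
  · intro a b h
    simpa using (Prod.mk.inj h).2
  · intro a b h
    simpa using (Prod.mk.inj h).2
  · rw [Finset.disjoint_left]
    simp only [Finset.mem_image, Finset.mem_Ico]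
    rintro p ⟨m, hm, rfl⟩ ⟨m', hm', h⟩
    have h1 := congrArg List.length (Prod.mk.inj h).1
    have h2 := (Prod.mk.inj h).2
    simp only [List.length_range'] at h1
    omega
  · rw [Finset.disjoint_left]
    simp only [Finset.mem_union, Finset.mem_image, Finset.mem_Ico]
    rintro p ⟨c, hc, rfl⟩ (⟨m, hm, h⟩ | ⟨m, hm, h⟩) <;>
    · have h1 := congrArg List.length (Prod.mk.inj h).1
      simp only [List.length_range', List.length_nil] at h1
      omega
end
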